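/- For an uncountable Polish space X, the Continuum Hypothesis holds if and only if there exists a lower density operator Φ : 𝓑 → 𝓑 on the σ-algebra 𝓑 of Borel subsets of X with respect to the σ-ideal of countable subsets of X. -/

import Mathlib

open Set Cardinal

/-- `Φ` is a lower density operator on the Borel σ-algebra of `X` with respect to the
σ-ideal of countable sets: it maps Borel sets to Borel sets and satisfies (1)–(4). -/
def IsCountableLowerDensity {X : Type*} [MeasurableSpace X] (Φ : Set X → Set X) : Prop :=
  (∀ A : Set X, MeasurableSet A → MeasurableSet (Φ A)) ∧
  (Φ Set.univ = Set.univ ∧ Φ ∅ = ∅) ∧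
  (∀ A B : Set X, MeasurableSet A → MeasurableSet B →
    (symmDiff A B).Countable → Φ A = Φ B) ∧
  (∀ A : Set X, MeasurableSet A → (symmDiff A (Φ A)).Countable) ∧
  (∀ A B : Set X, MeasurableSet A → MeasurableSet B → Φ (A ∩ B) = Φ A ∩ Φ B)

/-- Sierpiński's theorem: if `α × α` is the union of a set with countable vertical sections and a
set with countable horizontal sections, then `α` has cardinality at most `ℵ₁`. -/
theorem mk_le_aleph_one_of_forall_mem_or_mem {α : Type*} (C D : α → Set α)
    (hC : ∀ x, (C x).Countable) (hD : ∀ y, (D y).Countable) (h : ∀ x y, y ∈ C x ∨ x ∈ D y) :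
    #α ≤ ℵ₁ := by
  by_contra! hα
  obtain ⟨S, hS⟩ := Cardinal.le_mk_iff_exists_set.1 hα.le
  have hU : #(⋃ x ∈ S, C x) ≤ ℵ₁ := by
    refine (mk_biUnion_le C S).trans ?_
    rw [hS]
    refine (mul_le_mul_right
      (ciSup_le' fun x : S => le_aleph0_iff_set_countable.2 (hC x.1)) _).trans ?_
    rw [mul_aleph0_eq aleph0_lt_aleph_one.le]
  obtain ⟨y, hy⟩ : ∃ y, y ∉ ⋃ x ∈ S, C x := by
    by_contra! hall
    rw [Set.eq_univ_of_forall hall, mk_univ] at hU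
    exact hα.not_ge hU
  have hSD : S ⊆ D y := fun x hx =>
    (h x y).resolve_left fun hxy => hy (mem_biUnion hx hxy)
  have := le_aleph0_iff_set_countable.2 ((hD y).mono hSD)
  rw [hS] at this
  exact this.not_gt aleph0_lt_aleph_one

theorem IsCountableLowerDensity.continuum_eq_aleph_one {X : Type} [TopologicalSpace X]
    [PolishSpace X] [MeasurableSpace X] [BorelSpace X] [Uncountable X] {Φ : Set X → Set X}
    (hΦ : IsCountableLowerDensity Φ) : 𝔠 = (ℵ₁ : Cardinal.{0}) := by
  obtain ⟨-, ⟨-, hempty⟩, hcongr, hsymm, hinter⟩ := hΦ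
  have e : X ≃ᵐ ℝ × ℝ := PolishSpace.measurableEquivOfNotCountable
    (not_countable) (not_countable)
  let V (x : ℝ) : Set X := {p | (e p).1 = x}
  let H (y : ℝ) : Set X := {p | (e p).2 = y}
  have hV (x : ℝ) : MeasurableSet (V x) :=
    (measurable_fst.comp e.measurable) (measurableSet_singleton x)
  have hH (y : ℝ) : MeasurableSet (H y) :=
    (measurable_snd.comp e.measurable) (measurableSet_singleton y)
  have hdisj (x y : ℝ) : Φ (V x) ∩ Φ (H y) = ∅ := by
    rw [← hinter _ _ (hV x) (hH y), ← hempty]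
    refine hcongr _ _ ((hV x).inter (hH y)) .empty ?_
    refine (countable_singleton (e.symm (x, y))).mono ?_
    rintro p (⟨⟨h₁, h₂⟩, -⟩ | ⟨h, -⟩)
    · exact (e.toEquiv.eq_symm_apply).2 (Prod.ext h₁ h₂)
    · exact h.elim
  refine le_antisymm ?_ aleph_one_le_continuum
  rw [← mk_real]
  refine mk_le_aleph_one_of_forall_mem_or_mem
    (fun x => {y | e.symm (x, y) ∉ Φ (V x)}) (fun y => {x | e.symm (x, y) ∉ Φ (H y)}) ?_ ?_ ?_
  · intro x
    refine Set.Countable.mono (fun y hy => ?_) ((hsymm _ (hV x)).preimage_of_injOn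
      (f := fun y => e.symm (x, y)) (fun y _ z _ hyz => ?_))
    · exact Or.inl ⟨by simp [V], hy⟩
    · simpa using hyz
  · intro y
    refine Set.Countable.mono (fun x hx => ?_) ((hsymm _ (hH y)).preimage_of_injOn
      (f := fun x => e.symm (x, y)) (fun x _ z _ hxz => ?_))
    · exact Or.inl ⟨by simp [H], hx⟩
    · simpa using hxz
  · intro x y
    by_contra! h
    simp only [mem_ofPred_eq, not_not] at h
    exact (hdisj x y).subset h

theorem exists_ordinal_rank_countable.{u} {α : Type u} (h : #α ≤ ℵ₁) :
    ∃ f : α → Ordinal.{u}, ∀ a, {b | f b ≤ f a}.Countable := by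
  rw [← card_ord ℵ₁, ← mk_toType] at h
  obtain ⟨g⟩ := h
  refine ⟨fun a => (g a).toOrd, fun a => ?_⟩
  have hIic : (Iic (g a)).Countable := by
    rw [← Iio_union_right, countable_union]
    refine ⟨?_, countable_singleton _⟩
    rw [← le_aleph0_iff_set_countable, ← Order.lt_succ_iff, succ_aleph0]
    simpa using mk_Iio_lt (g a)
  refine (hIic.preimage_of_injOn g.injective.injOn).mono fun b hb => ?_
  have hb' : (g b).toOrd ≤ (g a).toOrd := hb
  exact (OrderIso.le_iff_le _).1 hb'

section LowerDensity

variable {X : Type*} [MeasurableSpace X] (f : {A : Set X // MeasurableSet A} → Ordinal)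

/-- The measurable sets of rank below `o`, together with their complements. -/
def signedSetsBelow (o : Ordinal) : Set (Set X) :=
  {B | ∃ A : {A : Set X // MeasurableSet A}, f A < o ∧ (B = A ∨ B = (A : Set X)ᶜ)}

/-- The union of all countable finite intersections of members of `signedSetsBelow f o`. -/
def exceptionalSet (o : Ordinal) : Set X :=
  ⋃₀ {C | C.Countable ∧ ∃ s ⊆ signedSetsBelow f o, s.Finite ∧ ⋂₀ s = C}

/-- The points `x` at which `A` contains, up to a countable set, a finite intersection of members
of some `signedSetsBelow f o` through `x`, where `x` is not exceptional at level `o`. -/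
def rankedLowerDensity (A : Set X) : Set X :=
  {x | ∃ o, x ∉ exceptionalSet f o ∧ ∃ s ⊆ signedSetsBelow f o, s.Finite ∧ x ∈ ⋂₀ s ∧
    (⋂₀ s \ A).Countable}

variable {f}

theorem signedSetsBelow_mono : Monotone (signedSetsBelow f) :=
  fun _ _ h _ ⟨A, hA, hB⟩ => ⟨A, hA.trans_le h, hB⟩

theorem exceptionalSet_zero [Uncountable X] : exceptionalSet f 0 = ∅ := by
  refine eq_empty_of_forall_notMem ?_
  rintro x ⟨C, ⟨hC, s, hs, -, rfl⟩, -⟩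
  obtain rfl : s = ∅ := eq_empty_of_forall_notMem fun B hB => by
    obtain ⟨A, hA, -⟩ := hs hB
    exact not_lt_zero hA
  rw [sInter_empty] at hC
  exact not_countable_univ hC

theorem countable_exceptionalSet {o : Ordinal} (ho : {A | f A < o}.Countable) :
    (exceptionalSet f o).Countable := by
  have hs : (signedSetsBelow f o).Countable := by
    refine ((ho.image fun A => (A : Set X)).union (ho.image fun A => (A : Set X)ᶜ)).mono ?_
    rintro B ⟨A, hA, rfl | rfl⟩
    · exact Or.inl ⟨A, hA, rfl⟩
    · exact Or.inr ⟨A, hA, rfl⟩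
  refine Countable.sUnion ?_ fun C hC => hC.1
  refine ((countable_ofPred_finite_subset hs).image sInter).mono ?_
  rintro C ⟨-, s, hs, hfin, rfl⟩
  exact ⟨s, ⟨hfin, hs⟩, rfl⟩

theorem notMem_exceptionalSet_iff {o : Ordinal} {x : X} :
    x ∉ exceptionalSet f o ↔
      ∀ s ⊆ signedSetsBelow f o, s.Finite → x ∈ ⋂₀ s → ¬ (⋂₀ s).Countable := by
  refine ⟨fun hx s hs hfin hxs hc => hx ⟨_, ⟨hc, s, hs, hfin, rfl⟩, hxs⟩, ?_⟩
  rintro h ⟨_, ⟨hC, s, hs, hfin, rfl⟩, hxs⟩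
  exact h s hs hfin hxs hC

theorem rankedLowerDensity_mono_of_countable_diff {A B : Set X} (h : (A \ B).Countable) :
    rankedLowerDensity f A ⊆ rankedLowerDensity f B := by
  rintro x ⟨o, hx, s, hs, hfin, hxs, hc⟩
  refine ⟨o, hx, s, hs, hfin, hxs, (hc.union h).mono ?_⟩
  rintro y ⟨hy, hyB⟩
  by_cases hyA : y ∈ A
  · exact Or.inr ⟨hyA, hyB⟩
  · exact Or.inl ⟨hy, hyA⟩

theorem rankedLowerDensity_inter (A B : Set X) :
    rankedLowerDensity f (A ∩ B) = rankedLowerDensity f A ∩ rankedLowerDensity f B := by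
  refine Subset.antisymm (subset_inter ?_ ?_) ?_
  · exact rankedLowerDensity_mono_of_countable_diff (by simp [sdiff_eq_empty.2 inter_subset_left])
  · exact rankedLowerDensity_mono_of_countable_diff (by simp [sdiff_eq_empty.2 inter_subset_right])
  · rintro x ⟨⟨o, hx, s, hs, hfin, hxs, hc⟩, ⟨o', hx', s', hs', hfin', hxs', hc'⟩⟩
    refine ⟨max o o', ?_, s ∪ s', union_subset (hs.trans (signedSetsBelow_mono (le_max_left _ _)))
      (hs'.trans (signedSetsBelow_mono (le_max_right _ _))), hfin.union hfin', ?_, ?_⟩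
    · rcases max_choice o o' with h | h <;> rwa [h]
    · rw [sInter_union]
      exact ⟨hxs, hxs'⟩
    · refine (hc.union hc').mono ?_
      rw [sInter_union]
      rintro y ⟨⟨hy, hy'⟩, hn⟩
      by_cases hyA : y ∈ A
      · exact Or.inr ⟨hy', fun hyB => hn ⟨hyA, hyB⟩⟩
      · exact Or.inl ⟨hy, hyA⟩

theorem rankedLowerDensity_empty : rankedLowerDensity f ∅ = ∅ := by
  refine eq_empty_of_forall_notMem ?_
  rintro x ⟨o, hx, s, hs, hfin, hxs, hc⟩
  rw [sdiff_empty] at hc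
  exact notMem_exceptionalSet_iff.1 hx s hs hfin hxs hc

theorem rankedLowerDensity_univ [Uncountable X] : rankedLowerDensity f Set.univ = Set.univ :=
  eq_univ_of_forall fun x =>
    ⟨0, by simp [exceptionalSet_zero], ∅, empty_subset _, finite_empty, by simp, by simp⟩

theorem symmDiff_rankedLowerDensity_subset (A : {A : Set X // MeasurableSet A}) :
    symmDiff (A : Set X) (rankedLowerDensity f A) ⊆ exceptionalSet f (Order.succ (f A)) := by
  have hlt : f A < Order.succ (f A) := Order.lt_succ _
  have hmem : (A : Set X) ∈ signedSetsBelow f (Order.succ (f A)) := ⟨A, hlt, Or.inl rfl⟩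
  have hmem' : (A : Set X)ᶜ ∈ signedSetsBelow f (Order.succ (f A)) := ⟨A, hlt, Or.inr rfl⟩
  intro x hx
  by_contra hxN
  rcases hx with ⟨hxA, hxΦ⟩ | ⟨hxΦ, hxA⟩
  · exact hxΦ ⟨_, hxN, {(A : Set X)}, by simpa using hmem, finite_singleton _, by simpa using hxA,
      by simp⟩
  · have hxΦ' : x ∈ rankedLowerDensity f (A : Set X)ᶜ :=
      ⟨_, hxN, {(A : Set X)ᶜ}, by simpa using hmem', finite_singleton _, by simpa using hxA,
        by simp⟩
    have : x ∈ rankedLowerDensity f ((A : Set X) ∩ (A : Set X)ᶜ) := by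
      rw [rankedLowerDensity_inter]
      exact ⟨hxΦ, hxΦ'⟩
    rw [inter_compl_self, rankedLowerDensity_empty] at this
    exact this

theorem isCountableLowerDensity_rankedLowerDensity [MeasurableSingletonClass X] [Uncountable X]
    (hf : ∀ A, {B | f B ≤ f A}.Countable) : IsCountableLowerDensity (rankedLowerDensity f) := by
  have hsymm (A : Set X) (hA : MeasurableSet A) :
      (symmDiff A (rankedLowerDensity f A)).Countable :=
    (countable_exceptionalSet (by simpa only [Order.lt_succ_iff] using hf ⟨A, hA⟩)).mono
      (symmDiff_rankedLowerDensity_subset ⟨A, hA⟩)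
  refine ⟨fun A hA => ?_, ⟨rankedLowerDensity_univ, rankedLowerDensity_empty⟩,
    fun A B _ _ h => ?_, hsymm, fun A B _ _ => rankedLowerDensity_inter A B⟩
  · rw [← symmDiff_symmDiff_cancel_left A (rankedLowerDensity f A)]
    exact hA.symmDiff (hsymm A hA).measurableSet
  · exact Subset.antisymm
      (rankedLowerDensity_mono_of_countable_diff (h.mono subset_union_left))
      (rankedLowerDensity_mono_of_countable_diff (h.mono subset_union_right))

end LowerDensity

theorem mk_measurableSet_le_continuum (X : Type*) [MeasurableSpace X]
    [MeasurableSpace.CountablyGenerated X] : #{A : Set X // MeasurableSet A} ≤ 𝔠 := by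
  obtain ⟨b, hb, hgen⟩ := MeasurableSpace.CountablyGenerated.isCountablyGenerated (α := X)
  subst hgen
  exact MeasurableSpace.cardinal_measurableSet_le_continuum
    ((le_aleph0_iff_set_countable.2 hb).trans aleph0_le_continuum)

theorem continuum_eq_aleph_one_iff.{u} :
    (𝔠 : Cardinal.{u}) = ℵ₁ ↔ (𝔠 : Cardinal.{0}) = ℵ₁ := by
  rw [← lift_continuum.{u, 0}, ← lift_inj.{0, u} (a := 𝔠) (b := ℵ₁)]
  simp

theorem ch_iff_exists_borel_lower_density (X : Type) [TopologicalSpace X] [PolishSpace X]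
    [MeasurableSpace X] [BorelSpace X] [Uncountable X] :
    Cardinal.continuum = Cardinal.aleph 1 ↔
      ∃ Φ : Set X → Set X, IsCountableLowerDensity Φ := by
  rw [continuum_eq_aleph_one_iff]
  refine ⟨fun hCH => ?_, fun ⟨Φ, hΦ⟩ => hΦ.continuum_eq_aleph_one⟩
  obtain ⟨f, hf⟩ := exists_ordinal_rank_countable ((mk_measurableSet_le_continuum X).trans hCH.le)
  exact ⟨_, isCountableLowerDensity_rankedLowerDensity hf⟩
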